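/- arXiv:1910.02997 — 3 statements merged into one kernel-verified Lean document; each statement's English description precedes it below -/
import Mathlib

section
/- Let X and Y be disjoint node sets in an MPDAG G = (V,E), and suppose there is no proper possibly causal path from X to Y in G that starts with an undirected edge. Let (B_1,…,B_k), k ≥ 1, be the bucket decomposition of An(Y, G_{V∖X}) ordered as a partial causal ordering in G, and let B = An(Y, G_{V∖X}) ∖ Y. Then for every DAG D in [G] and every strictly positive discrete observational density f over V consistent with D, the marginal over Y of the interventional density obtained from f by truncated factorization with respect to D satisfies f(y|do(x)) = Σ_b ∏_{i=1}^{k} f(b_i | pa(b_i,G)), where the values pa(b_i,G) of Pa(B_i,G) are in agreement with x and the sum is over the values b of B. In particular f(y|do(x)) is the same for every DAG in [G] consistent with f. -/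
open scoped Classical

noncomputable section

/-- A partially directed graph on node type `V`: directed (`dir`) and undirected (`undir`)
edges, with at most one edge between any two nodes. -/
structure PDG (V : Type) where
  dir : V → V → Prop
  undir : V → V → Prop
  undir_symm : ∀ a b, undir a b → undir b a
  dir_irrefl : ∀ a, ¬ dir a a
  undir_irrefl : ∀ a, ¬ undir a a
  dir_asymm : ∀ a b, dir a b → ¬ dir b a
  dir_not_undir : ∀ a b, dir a b → ¬ undir a b

namespace PDG

variable {V : Type}

/-- Two nodes are adjacent if there is an edge between them. -/
def Adj (G : PDG V) (a b : V) : Prop := G.dir a b ∨ G.dir b a ∨ G.undir a b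

/-- No directed cycles. -/
def Acyclic (G : PDG V) : Prop := ∀ a, ¬ Relation.TransGen G.dir a a

/-- A maximally oriented PDAG (MPDAG): a partially directed graph with no directed
cycles, in which none of the four configurations of Meek's orientation rules occurs
as an induced subgraph. -/
structure IsMPDAG (G : PDG V) : Prop where
  acyclic : G.Acyclic
  meek1 : ∀ a b c, G.dir a b → G.undir b c → G.Adj a c
  meek2 : ∀ a b c, G.dir a b → G.dir b c → ¬ G.undir a c
  meek3 : ∀ i j k l, k ≠ l → G.undir i j → G.undir i k → G.undir i l →
      G.dir k j → G.dir l j → G.Adj k l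
  meek4 : ∀ i j k l, G.undir i j → G.undir i k → G.undir i l →
      G.dir j l → G.dir l k → G.Adj j k

/-- A DAG: only directed edges, no directed cycles. -/
def IsDAG (G : PDG V) : Prop := (∀ a b, ¬ G.undir a b) ∧ G.Acyclic

/-- `⟨a,b,c⟩` is an unshielded collider. -/
def UnshieldedCollider (G : PDG V) (a b c : V) : Prop :=
  a ≠ c ∧ G.dir a b ∧ G.dir c b ∧ ¬ G.Adj a c

/-- `D ∈ [G]` : `D` is a DAG represented by the MPDAG `G`: same adjacencies,
same unshielded colliders, containing every directed edge of `G`. -/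
def InClassOf (D G : PDG V) : Prop :=
  IsDAG D ∧ (∀ a b, G.Adj a b ↔ D.Adj a b) ∧
    (∀ a b c, G.UnshieldedCollider a b c ↔ D.UnshieldedCollider a b c) ∧
    (∀ a b, G.dir a b → D.dir a b)

/-- `p` is a path: a sequence of at least two distinct nodes in which every pair of
successive nodes is adjacent. -/
def IsPath (G : PDG V) (p : List V) : Prop :=
  2 ≤ p.length ∧ p.Nodup ∧ p.Chain' G.Adj

/-- `p` is a path from `a` to `b`. -/
def IsPathFrom (G : PDG V) (p : List V) (a b : V) : Prop :=
  G.IsPath p ∧ p.head? = some a ∧ p.getLast? = some b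

/-- `p` is a possibly causal path: no edge `V_i ← V_j` with `i < j` is in `G`. -/
def PossiblyCausal (G : PDG V) (p : List V) : Prop :=
  G.IsPath p ∧ ∀ i j : Fin p.length, (i : ℕ) < (j : ℕ) → ¬ G.dir (p.get j) (p.get i)

/-- `p` is a causal path: all edges directed towards the endpoint. -/
def IsCausal (G : PDG V) (p : List V) : Prop :=
  2 ≤ p.length ∧ p.Nodup ∧ p.Chain' G.dir

/-- `p` is an undirected path. -/
def IsUndirPath (G : PDG V) (p : List V) : Prop :=
  p ≠ [] ∧ p.Nodup ∧ p.Chain' G.undir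

/-- `p` is unshielded: every two nodes at distance two on `p` are nonadjacent. -/
def Unshielded (G : PDG V) (p : List V) : Prop :=
  ∀ (i : ℕ) (h : i + 2 < p.length),
    ¬ G.Adj (p.get ⟨i, by omega⟩) (p.get ⟨i + 2, h⟩)

/-- `p` is proper w.r.t. the node set `X` : only its first node is in `X`. -/
def ProperFrom (X : Finset V) (p : List V) : Prop :=
  (∃ a ∈ X, p.head? = some a) ∧ ∀ i : Fin p.length, 0 < (i : ℕ) → p.get i ∉ X

/-- the last node of `p` is in `Y`. -/
def EndsIn (Y : Finset V) (p : List V) : Prop := ∃ b ∈ Y, p.getLast? = some b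

/-- `p` starts with an undirected edge. -/
def StartsUndirected (G : PDG V) (p : List V) : Prop :=
  ∃ a b l, p = a :: b :: l ∧ G.undir a b

/-- There is no proper possibly causal path from `X` to `Y` in `G` that starts with
an undirected edge. -/
def NoProperPCUndirStart (G : PDG V) (X Y : Finset V) : Prop :=
  ¬ ∃ p, G.PossiblyCausal p ∧ ProperFrom X p ∧ EndsIn Y p ∧ G.StartsUndirected p

/-- `A` is an undirected connected node set in `G`: every two distinct nodes of `A`
are joined by an undirected path in `G`. -/
def UndirConnected (G : PDG V) (A : Finset V) : Prop :=
  ∀ a ∈ A, ∀ b ∈ A, a ≠ b →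
    ∃ p, G.IsUndirPath p ∧ p.head? = some a ∧ p.getLast? = some b

/-- `B` is a bucket in `D`: a maximal undirected connected subset of `D` in `G`. -/
def Bucket (G : PDG V) (B D : Finset V) : Prop :=
  B.Nonempty ∧ B ⊆ D ∧ G.UndirConnected B ∧
    ∀ B' : Finset V, B ⊆ B' → B' ⊆ D → G.UndirConnected B' → B' = B

section DecEq

variable [DecidableEq V]

/-- `Bs` lists the bucket decomposition of `D`: the listed sets are buckets in `D`,
pairwise disjoint, with union `D`. -/
def IsBucketDecompList (G : PDG V) (D : Finset V) (Bs : List (Finset V)) : Prop :=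
  (∀ B ∈ Bs, G.Bucket B D) ∧ (Bs.Pairwise fun B B' => Disjoint B B') ∧
    Bs.foldr (· ∪ ·) ∅ = D

end DecEq

/-- The listed node sets are totally ordered as a partial causal ordering in `G` :
every edge between an earlier set and a later one points towards the later one. -/
def OrderedDecomp (G : PDG V) (Bs : List (Finset V)) : Prop :=
  ∀ i j : Fin Bs.length, (i : ℕ) < (j : ℕ) →
    ∀ a ∈ Bs.get i, ∀ b ∈ Bs.get j, G.Adj a b → G.dir a b

/-- the node at (interior) position `i` of `p` is a collider on `p`. -/
def ColliderAt (G : PDG V) (p : List V) (i : ℕ) : Prop :=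
  ∃ u v w, p[i-1]? = some u ∧ p[i]? = some v ∧ p[i+1]? = some w ∧
    1 ≤ i ∧ G.dir u v ∧ G.dir w v

/-- the node at (interior) position `i` of `p` is a definite non-collider on `p`. -/
def DefNonColliderAt (G : PDG V) (p : List V) (i : ℕ) : Prop :=
  ∃ u v w, p[i-1]? = some u ∧ p[i]? = some v ∧ p[i+1]? = some w ∧ 1 ≤ i ∧
    (G.dir v u ∨ G.dir v w ∨ (G.undir u v ∧ G.undir v w ∧ ¬ G.Adj u w))

/-- `p` is a definite status path: every interior node is a collider or a definite
non-collider on `p`. -/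
def DefiniteStatus (G : PDG V) (p : List V) : Prop :=
  ∀ i : ℕ, 1 ≤ i → i + 1 < p.length → G.ColliderAt p i ∨ G.DefNonColliderAt p i

/-- `p` is d-connecting given `Z` (in a DAG): every non-collider on `p` is outside
`Z` and every collider on `p` has a descendant in `Z`. -/
def DConnGiven (G : PDG V) (Z : Finset V) (p : List V) : Prop :=
  (∀ i u, 1 ≤ i → i + 1 < p.length → p[i]? = some u → ¬ G.ColliderAt p i → u ∉ Z) ∧
  (∀ i u, G.ColliderAt p i → p[i]? = some u →
    ∃ z ∈ Z, Relation.ReflTransGen G.dir u z)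

/-- `A` and `B` are d-separated given `Z` : no path between them is d-connecting
given `Z`. -/
def DSep (G : PDG V) (A B Z : Finset V) : Prop :=
  ∀ p a b, a ∈ A → b ∈ B → G.IsPathFrom p a b → ¬ G.DConnGiven Z p

/-- `p` is d-connecting given `Z` (definite status version): every definite
non-collider on `p` is outside `Z` and every collider on `p` has a descendant in `Z`. -/
def DConnDS (G : PDG V) (Z : Finset V) (p : List V) : Prop :=
  (∀ i u, G.DefNonColliderAt p i → p[i]? = some u → u ∉ Z) ∧
  (∀ i u, G.ColliderAt p i → p[i]? = some u →
    ∃ z ∈ Z, Relation.ReflTransGen G.dir u z)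

/-- `Z` blocks the (definite status) path `p`. -/
def Blocks (G : PDG V) (Z : Finset V) (p : List V) : Prop := ¬ G.DConnDS Z p

/-- `D_{X̄}` : remove all edges into `X`. -/
def removeInto (D : PDG V) (X : Finset V) : PDG V where
  dir a b := D.dir a b ∧ b ∉ X
  undir := D.undir
  undir_symm := D.undir_symm
  dir_irrefl := fun a h => D.dir_irrefl a h.1
  undir_irrefl := D.undir_irrefl
  dir_asymm := fun a b h h' => D.dir_asymm a b h.1 h'.1
  dir_not_undir := fun a b h => D.dir_not_undir a b h.1

/-- `D_{X̲}` : remove all edges out of `X`. -/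
def removeOutOf (D : PDG V) (X : Finset V) : PDG V where
  dir a b := D.dir a b ∧ a ∉ X
  undir := D.undir
  undir_symm := D.undir_symm
  dir_irrefl := fun a h => D.dir_irrefl a h.1
  undir_irrefl := D.undir_irrefl
  dir_asymm := fun a b h h' => D.dir_asymm a b h.1 h'.1
  dir_not_undir := fun a b h => D.dir_not_undir a b h.1

/-- `w'` is a possible descendant of `w` in `G`. -/
def PossibleDesc (G : PDG V) (w w' : V) : Prop :=
  w = w' ∨ ∃ p, G.PossiblyCausal p ∧ p.head? = some w ∧ p.getLast? = some w'

section Fin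

variable [Fintype V] [DecidableEq V]

/-- the parents of the node `v` in `G`. -/
def paFin (G : PDG V) (v : V) : Finset V := Finset.univ.filter fun u => G.dir u v

/-- `Pa(S, G)` : the parents of the node set `S` in `G`, excluding `S` itself. -/
def PaFin (G : PDG V) (S : Finset V) : Finset V :=
  (Finset.univ.filter fun u => ∃ v ∈ S, G.dir u v) \ S

/-- `a` is an ancestor of `y` within the induced subgraph of `G` on `S`
(every node is an ancestor of itself). -/
def AncestorIn (G : PDG V) (S : Finset V) (a y : V) : Prop :=
  a ∈ S ∧ y ∈ S ∧ Relation.ReflTransGen (fun u v => G.dir u v ∧ u ∈ S ∧ v ∈ S) a y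

/-- `An(Y, G_S)` : the ancestors of `Y` in the induced subgraph of `G` on `S`. -/
def AnIn (G : PDG V) (Y S : Finset V) : Finset V :=
  Finset.univ.filter fun a => ∃ y ∈ Y, G.AncestorIn S a y

/-- `forb(X, Y, G)` for single nodes `X`, `Y` : all possible descendants of nodes
`W ≠ X` lying on a proper possibly causal path from `X` to `Y` in `G`. -/
def Forb (G : PDG V) (X Y : V) : Finset V :=
  Finset.univ.filter fun w' => ∃ w, w ≠ X ∧
    (∃ p, G.PossiblyCausal p ∧ p.head? = some X ∧ p.getLast? = some Y ∧ w ∈ p) ∧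
    G.PossibleDesc w w'

end Fin

end PDG

section Density

open PDG

variable {V : Type} [Fintype V] [DecidableEq V] {Ω : Type} [Fintype Ω] [DecidableEq Ω]

/-- the marginal of `f` over the node set `S`, at the values given by `g`. -/
def margin (f : (V → Ω) → ℝ) (S : Finset V) (g : V → Ω) : ℝ :=
  ∑ h : V → Ω, if ∀ v ∈ S, h v = g v then f h else 0

/-- the conditional density `f(a | b)` of `A` given `B`, at the values given by `g`. -/
def condOn (f : (V → Ω) → ℝ) (A B : Finset V) (g : V → Ω) : ℝ :=
  margin f (A ∪ B) g / margin f B g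

/-- `f` is a strictly positive discrete density over `V`. -/
def IsPosDensity (f : (V → Ω) → ℝ) : Prop :=
  (∀ g, 0 < f g) ∧ ∑ g : V → Ω, f g = 1

/-- `f` is consistent with the DAG `D` : it factorizes according to `D`. -/
def ConsistentWith (f : (V → Ω) → ℝ) (D : PDG V) : Prop :=
  ∀ g, f g = ∏ v : V, condOn f {v} (D.paFin v) g

/-- the interventional density obtained from `f` by truncated factorization with
respect to the DAG `D` under `do(X = x)`, evaluated at `g` (parent values in `X`
are taken in agreement with `x`). -/
def doDens (f : (V → Ω) → ℝ) (D : PDG V) (X : Finset V) (x : V → Ω) (g : V → Ω) : ℝ :=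
  ∏ v ∈ Finset.univ \ X, condOn f {v} (D.paFin v) fun u => if u ∈ X then x u else g u

/-- `f(y | do(x))` : the marginal over `Y` of the interventional density obtained
from `f` by truncated factorization with respect to `D`. -/
def doMargin (f : (V → Ω) → ℝ) (D : PDG V) (X : Finset V) (x : V → Ω)
    (Y : Finset V) (y : V → Ω) : ℝ :=
  ∑ g : V → Ω,
    if (∀ v ∈ X, g v = x v) ∧ (∀ v ∈ Y, g v = y v) then doDens f D X x g else 0

end Density

namespace PDG

variable {V : Type}

/-- `b` is reachable from `a` along undirected edges. -/
def UReach (G : PDG V) (a b : V) : Prop := Relation.ReflTransGen G.undir a b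

lemma UReach.symm {G : PDG V} {a b : V} (h : G.UReach a b) : G.UReach b a := by
  induction h with
  | refl => exact Relation.ReflTransGen.refl
  | tail _ hcd ih => exact ih.head (G.undir_symm _ _ hcd)

lemma UReach.trans {G : PDG V} {a b c : V} (h : G.UReach a b) (h' : G.UReach b c) :
    G.UReach a c := Relation.ReflTransGen.trans h h'

/-- A directed edge into one end of an undirected edge is completed by an edge to the
other end, which is either undirected or directed towards that end. -/
lemma IsMPDAG.dir_or_undir {G : PDG V} (hG : G.IsMPDAG) {a b c : V} (hab : G.dir a b)
    (hbc : G.undir b c) : G.dir a c ∨ G.undir a c := by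
  rcases hG.meek1 a b c hab hbc with h | h | h
  · exact Or.inl h
  · exact absurd (G.undir_symm _ _ hbc) (hG.meek2 c a b h hab)
  · exact Or.inr h

lemma IsMPDAG.dir_or_ureach {G : PDG V} (hG : G.IsMPDAG) {a b c : V} (hab : G.dir a b)
    (hbc : G.UReach b c) : G.dir a c ∨ G.UReach a c := by
  induction hbc with
  | refl => exact Or.inl hab
  | tail _ hcd ih =>
    rcases ih with h | h
    · exact (hG.dir_or_undir h hcd).imp id Relation.ReflTransGen.single
    · exact Or.inr (h.tail hcd)

lemma UndirConnected.ureach {G : PDG V} {A : Finset V} (hA : G.UndirConnected A) {a b : V}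
    (ha : a ∈ A) (hb : b ∈ A) : G.UReach a b := by
  by_cases hab : a = b
  · subst hab; exact Relation.ReflTransGen.refl
  obtain ⟨p, ⟨hne, -, hch⟩, h1, h2⟩ := hA a ha b hb hab
  have hch : p.IsChain G.undir := hch
  obtain ⟨c, l, rfl⟩ := List.exists_cons_of_ne_nil hne
  simp only [List.head?_cons, Option.some.injEq] at h1
  subst h1
  have hlast := List.relationReflTransGen_of_exists_isChain_cons l hch
    (b := b) (by
      rw [List.getLast?_eq_getLast_of_ne_nil (by simp)] at h2
      exact Option.some.inj h2)
  exact hlast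

lemma UReach.exists_isUndirPath {G : PDG V} {a b : V} (h : G.UReach a b) :
    ∃ p, G.IsUndirPath p ∧ p.head? = some a ∧ p.getLast? = some b := by
  let H : SimpleGraph V :=
    { Adj := G.undir
      symm := ⟨fun a b hab => G.undir_symm a b hab⟩
      loopless := ⟨fun a => G.undir_irrefl a⟩ }
  have hr : H.Reachable a b := by
    induction h with
    | refl => exact SimpleGraph.Reachable.refl _
    | tail _ hcd ih =>
      have hcd : H.Adj _ _ := hcd
      exact ih.trans hcd.reachable
  obtain ⟨w⟩ := hr
  have hp := w.toPath.2
  refine ⟨(w.toPath : H.Walk a b).support, ⟨SimpleGraph.Walk.support_ne_nil _,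
    hp.support_nodup, ?_⟩, ?_, ?_⟩
  · exact (w.toPath : H.Walk a b).isChain_adj_support
  · rw [List.head?_eq_some_head (SimpleGraph.Walk.support_ne_nil _)]
    simp
  · rw [List.getLast?_eq_getLast_of_ne_nil (SimpleGraph.Walk.support_ne_nil _)]
    simp

/-- A bucket consists of all nodes of the ambient set which are reachable from any of
its nodes along undirected edges. -/
lemma Bucket.mem_iff {G : PDG V} {B S : Finset V} (hB : G.Bucket B S) {b : V} (hb : b ∈ B)
    (a : V) : a ∈ B ↔ a ∈ S ∧ G.UReach b a := by
  obtain ⟨-, hBS, hconn, hmax⟩ := hB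
  refine ⟨fun ha => ⟨hBS ha, hconn.ureach hb ha⟩, fun ⟨haS, hba⟩ => ?_⟩
  have key : ∀ c ∈ insert a B, G.UReach b c := by
    intro c hc
    rcases Finset.mem_insert.1 hc with rfl | hc
    · exact hba
    · exact hconn.ureach hb hc
  rw [← hmax (insert a B) (Finset.subset_insert _ _)
    (Finset.insert_subset haS hBS)
    fun c hc d hd _ => ((key c hc).symm.trans (key d hd)).exists_isUndirPath]
  exact Finset.mem_insert_self _ _

section Ancestors

variable [Fintype V]

lemma mem_AnIn {G : PDG V} {Y S : Finset V} {a : V} :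
    a ∈ G.AnIn Y S ↔ ∃ y ∈ Y, G.AncestorIn S a y := by
  simp [AnIn]

lemma AnIn_subset (G : PDG V) (Y S : Finset V) : G.AnIn Y S ⊆ S := fun a ha => by
  obtain ⟨y, -, h, -⟩ := mem_AnIn.1 ha
  exact h

lemma mem_AnIn_self {G : PDG V} {Y S : Finset V} {y : V} (hy : y ∈ Y) (hS : y ∈ S) :
    y ∈ G.AnIn Y S := mem_AnIn.2 ⟨y, hy, hS, hS, Relation.ReflTransGen.refl⟩

lemma mem_AnIn_of_dir {G : PDG V} {Y S : Finset V} {u z : V} (hz : z ∈ G.AnIn Y S)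
    (huz : G.dir u z) (hu : u ∈ S) : u ∈ G.AnIn Y S := by
  obtain ⟨y, hy, hzS, hyS, h⟩ := mem_AnIn.1 hz
  exact mem_AnIn.2 ⟨y, hy, hu, hyS, h.head ⟨huz, hu, hzS⟩⟩

lemma AnIn_induction {G : PDG V} {Y S : Finset V} {P : V → Prop}
    (h0 : ∀ y ∈ Y, y ∈ S → P y)
    (h1 : ∀ u z, u ∈ S → G.dir u z → z ∈ G.AnIn Y S → P z → P u) :
    ∀ z ∈ G.AnIn Y S, P z := by
  intro z hz
  obtain ⟨y, hy, hzS, hyS, h⟩ := mem_AnIn.1 hz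
  clear hz hzS
  induction h using Relation.ReflTransGen.head_induction_on with
  | refl => exact h0 y hy hyS
  | head hab hbc ih =>
    exact h1 _ _ hab.2.1 hab.1 (mem_AnIn.2 ⟨y, hy, hab.2.2, hyS, hbc⟩) ih

lemma AnIn_mono {G D : PDG V} (h : ∀ a b, G.dir a b → D.dir a b) (Y S : Finset V) :
    G.AnIn Y S ⊆ D.AnIn Y S :=
  AnIn_induction (fun _ => mem_AnIn_self)
    fun _ _ hu huz _ hz => mem_AnIn_of_dir hz (h _ _ huz) hu

lemma exists_path_of_mem_AnIn {G : PDG V} {Y S : Finset V} :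
    ∀ z ∈ G.AnIn Y S, ∃ l, (z :: l).IsChain G.dir ∧ (∀ v ∈ z :: l, v ∈ G.AnIn Y S) ∧
      EndsIn Y (z :: l) := by
  refine AnIn_induction (fun y hy hyS => ⟨[], by simp, ?_, y, hy, rfl⟩) ?_
  · simpa using mem_AnIn_self hy hyS
  · rintro u z hu huz hz ⟨l, h1, h2, b, hb, h3⟩
    refine ⟨z :: l, List.isChain_cons_cons.2 ⟨huz, h1⟩, ?_, b, hb, by simpa using h3⟩
    rintro v (_ | ⟨_, hv⟩)
    · exact mem_AnIn_of_dir hz huz hu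
    · exact h2 v hv

lemma Acyclic.exists_sink {D : PDG V} (hD : D.Acyclic) {S : Finset V}
    (hS : S.Nonempty) : ∃ v ∈ S, ∀ u ∈ S, ¬ Relation.TransGen D.dir v u := by
  have : IsTrans V (Function.swap (Relation.TransGen D.dir)) :=
    ⟨fun a b c hab hbc => Relation.TransGen.trans hbc hab⟩
  have : Std.Irrefl (Function.swap (Relation.TransGen D.dir)) := ⟨fun a => hD a⟩
  have hwf := Finite.wellFounded_of_trans_of_irrefl (Function.swap (Relation.TransGen D.dir))
  obtain ⟨v, hv, h⟩ := hwf.has_min (S : Set V) hS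
  exact ⟨v, hv, fun u hu => h u hu⟩

lemma mem_paFin {D : PDG V} {u v : V} : u ∈ D.paFin v ↔ D.dir u v := by simp [paFin]

end Ancestors

lemma exists_suffix_of_mem {X : Finset V} : ∀ U : List V, (∃ a ∈ U, a ∈ X) →
    (∀ c, U.getLast? = some c → c ∉ X) →
    ∃ q b l, q :: b :: l <:+ U ∧ q ∈ X ∧ ∀ v ∈ b :: l, v ∉ X := by
  intro U
  induction U with
  | nil => rintro ⟨a, ha, -⟩; simp at ha
  | cons u U ih =>
    rintro ⟨a, ha, haX⟩ hlast
    cases U with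
    | nil =>
      simp only [List.mem_singleton] at ha
      exact absurd haX (hlast a (by simp [ha]))
    | cons b l =>
      by_cases h : ∃ a ∈ b :: l, a ∈ X
      · obtain ⟨q, b', l', hs, h1, h2⟩ := ih h fun c hc => hlast c (by simpa using hc)
        exact ⟨q, b', l', hs.trans (List.suffix_cons _ _), h1, h2⟩
      · push Not at h
        rcases List.mem_cons.1 ha with rfl | ha
        · exact ⟨a, b, l, List.suffix_rfl, haX, h⟩
        · exact absurd haX (h a ha)

lemma NoProperPCUndirStart.false_of_list {G : PDG V} {X Y : Finset V}
    (hno : G.NoProperPCUndirStart X Y) {q b : V} {l : List V} (hq : q ∈ X)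
    (hqb : G.undir q b) (hX : ∀ v ∈ b :: l, v ∉ X) (hch : (q :: b :: l).IsChain G.Adj)
    (hpw : (q :: b :: l).Pairwise fun u v => u ≠ v ∧ ¬ G.dir v u)
    (hY : EndsIn Y (q :: b :: l)) : False := by
  refine hno ⟨q :: b :: l, ⟨⟨by simp, hpw.imp fun h => h.1, hch⟩, ?_⟩,
    ⟨⟨q, hq, rfl⟩, ?_⟩, hY, q, b, l, rfl, hqb⟩
  · intro i j hij
    exact (List.pairwise_iff_get.1 hpw i j hij).2
  · rintro ⟨i, hi⟩ h0
    cases i with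
    | zero => simp at h0
    | succ i => exact hX _ (by
        simp only [List.get_eq_getElem, List.getElem_cons_succ]
        exact List.getElem_mem _)

lemma pairwise_of_isChain_dir {D : PDG V} {l : List V} (h : l.IsChain D.dir) :
    l.Pairwise fun u v => Relation.TransGen D.dir u v := by
  have h' : l.IsChain (Relation.TransGen D.dir) := h.imp fun _ _ => Relation.TransGen.single
  exact List.isChain_iff_pairwise.1 h'

end PDG

namespace PDG

variable {V : Type} {G D : PDG V}

lemma InClassOf.dir_of_dir (hD : D.InClassOf G) {a b : V} (h : G.dir a b) : D.dir a b :=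
  hD.2.2.2 a b h

lemma InClassOf.adj_of_dir (hD : D.InClassOf G) {a b : V} (h : D.dir a b) : G.Adj a b :=
  (hD.2.1 a b).2 (Or.inl h)

lemma InClassOf.dir_or_dir (hD : D.InClassOf G) {a b : V} (h : G.Adj a b) :
    D.dir a b ∨ D.dir b a := by
  rcases (hD.2.1 a b).1 h with h | h | h
  · exact Or.inl h
  · exact Or.inr h
  · exact absurd h (hD.1.1 a b)

lemma InClassOf.dir_or_undir (hD : D.InClassOf G) {a b : V} (h : D.dir a b) :
    G.dir a b ∨ G.undir a b := by
  rcases hD.adj_of_dir h with h' | h' | h'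
  · exact Or.inl h'
  · exact absurd (hD.dir_of_dir h') (D.dir_asymm _ _ h)
  · exact Or.inr h'

section Fin

variable [Fintype V] [DecidableEq V] {X Y : Finset V}

/-- An edge of `D` from `X` to an ancestor of `Y` is already directed in `G`. -/
lemma InClassOf.dir_of_mem_AnIn (hD : D.InClassOf G) (hno : G.NoProperPCUndirStart X Y)
    {x z : V} (hx : x ∈ X) (hz : z ∈ D.AnIn Y (Finset.univ \ X)) (hxz : D.dir x z) :
    G.dir x z := by
  refine (hD.dir_or_undir hxz).resolve_right fun hu => ?_
  obtain ⟨l, hch, hmem, hend⟩ := exists_path_of_mem_AnIn z hz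
  have hch' : (x :: z :: l).IsChain D.dir := List.isChain_cons_cons.2 ⟨hxz, hch⟩
  have hpw := (pairwise_of_isChain_dir hch').imp
    (S := fun u v => u ≠ v ∧ ¬ G.dir v u) fun {u v} h =>
      ⟨fun e => hD.1.2 u (by rw [← e] at h; exact h),
        fun h' => hD.1.2 _ (h.tail (hD.dir_of_dir h'))⟩
  refine hno.false_of_list hx hu (l := l) (fun v hv => ?_)
    (hch'.imp fun a b h => hD.adj_of_dir h) hpw ?_
  · simpa using AnIn_subset _ _ _ (hmem v hv)
  · obtain ⟨b, hb, h⟩ := hend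
    exact ⟨b, hb, by simpa using h⟩

/-- Every ancestor of `Y` in `D` is joined by undirected edges to an ancestor of `Y`
in `G`. -/
lemma InClassOf.exists_ureach (hG : G.IsMPDAG) (hD : D.InClassOf G) :
    ∀ w ∈ D.AnIn Y (Finset.univ \ X), ∃ a ∈ G.AnIn Y (Finset.univ \ X), G.UReach w a := by
  refine AnIn_induction (fun y hy hyS => ⟨y, mem_AnIn_self hy hyS,
    Relation.ReflTransGen.refl⟩) ?_
  rintro u z hu huz - ⟨a, ha, hza⟩
  rcases hD.dir_or_undir huz with h | h
  · rcases hG.dir_or_ureach h hza with h' | h'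
    · exact ⟨u, mem_AnIn_of_dir ha h' hu, Relation.ReflTransGen.refl⟩
    · exact ⟨a, ha, h'⟩
  · exact ⟨a, ha, hza.head h⟩

end Fin

/-- `G.Frontier p k v`: there is an undirected walk of length `k` to `v` from an
undirected neighbour of `p`, all nodes of which after the first are children of `p`. -/
def Frontier (G : PDG V) (p : V) : ℕ → V → Prop
  | 0, v => G.undir p v
  | k + 1, v => G.dir p v ∧ ∃ u, G.Frontier p k u ∧ G.undir u v

/-- `v` is at level exactly `k` with respect to `G.Frontier p`. -/
def Level (G : PDG V) (p : V) (k : ℕ) (v : V) : Prop :=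
  G.Frontier p k v ∧ ∀ j < k, ¬ G.Frontier p j v

lemma Level.unique {p v : V} {i j : ℕ} (hi : G.Level p i v) (hj : G.Level p j v) : i = j := by
  rcases lt_trichotomy i j with h | h | h
  · exact absurd hi.1 (hj.2 i h)
  · exact h
  · exact absurd hj.1 (hi.2 j h)

lemma Level.exists_walk {p : V} : ∀ {k : ℕ} {v : V}, G.Level p k v →
    ∃ n : ℕ → V, n k = v ∧ (∀ i ≤ k, G.Level p i (n i)) ∧
      ∀ i < k, G.undir (n i) (n (i + 1)) := by
  intro k
  induction k with
  | zero =>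
    intro v hv
    exact ⟨fun _ => v, rfl, fun i hi => by obtain rfl := Nat.le_zero.1 hi; exact hv,
      fun i hi => absurd hi (Nat.not_lt_zero _)⟩
  | succ k ih =>
    rintro v ⟨⟨hpv, u, hu, huv⟩, hmin⟩
    obtain ⟨n, h1, h2, h3⟩ := ih (v := u)
      ⟨hu, fun j hj hju => hmin (j + 1) (by omega) ⟨hpv, u, hju, huv⟩⟩
    refine ⟨fun i => if i ≤ k then n i else v, by simp, fun i hi => ?_, fun i hi => ?_⟩
    · dsimp only
      split_ifs with h
      · exact h2 i h
      · obtain rfl : i = k + 1 := by omega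
        exact ⟨⟨hpv, u, hu, huv⟩, hmin⟩
    · dsimp only
      rw [if_pos (by omega)]
      split_ifs with h
      · exact h3 i (by omega)
      · obtain rfl : i = k := by omega
        rwa [h1]

lemma IsMPDAG.exists_frontier (hG : G.IsMPDAG) {p u n : V} (hun : G.UReach u n)
    (hpu : G.dir p u) (hpn : ¬ G.dir p n) : ∃ k, G.Frontier p (k + 1) u := by
  induction hun using Relation.ReflTransGen.head_induction_on with
  | refl => exact absurd hpu hpn
  | @head a c hac _ ih =>
    rcases hG.dir_or_undir hpu hac with h | h
    · obtain ⟨k, hk⟩ := ih h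
      exact ⟨k + 1, hpu, _, hk, G.undir_symm _ _ hac⟩
    · exact ⟨0, hpu, c, h, G.undir_symm _ _ hac⟩

/-- A child `v` of `p` pointing to a node of a walk starting at an undirected neighbour
of `p` is undirectedly adjacent to an earlier node of the walk. -/
lemma IsMPDAG.exists_undir_lt (hG : G.IsMPDAG) {p v : V} {n : ℕ → V} {r : ℕ}
    (hp : G.undir p (n 0)) (hn : ∀ i < r, G.undir (n i) (n (i + 1))) (hpv : G.dir p v) :
    ∀ i ≤ r, G.dir v (n i) → ∃ j < i, G.undir v (n j) := by
  intro i
  induction i with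
  | zero => intro _ h; exact absurd hp (hG.meek2 _ _ _ hpv h)
  | succ i ih =>
    intro hi h
    rcases hG.dir_or_undir h (G.undir_symm _ _ (hn i (by omega))) with h' | h'
    · obtain ⟨j, hj, h⟩ := ih (by omega) h'
      exact ⟨j, by omega, h⟩
    · exact ⟨i, by omega, h'⟩

lemma IsMPDAG.exists_undir_gt (hG : G.IsMPDAG) {v : V} {n : ℕ → V} {r : ℕ}
    (hn : ∀ i < r, G.undir (n i) (n (i + 1))) {i : ℕ} (hi : i ≤ r) (h : G.dir v (n i))
    (hr : ¬ G.dir v (n r)) : ∃ j, i < j ∧ j ≤ r ∧ G.undir v (n j) := by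
  induction hi using Nat.decreasingInduction with
  | self => exact absurd h hr
  | of_succ i hi ih =>
    rcases hG.dir_or_undir h (hn i hi) with h' | h'
    · obtain ⟨j, h1, h2, h3⟩ := ih h'
      exact ⟨j, by omega, h2, h3⟩
    · exact ⟨i + 1, by omega, hi, h'⟩

section Fin

variable [Fintype V] [DecidableEq V] {X Y : Finset V}

/-- A node of `X` which is a parent of an ancestor `v` of `Y` is a parent of every node
which is reachable from `v` along undirected edges. -/
theorem InClassOf.dir_of_ureach (hG : G.IsMPDAG) (hD : D.InClassOf G)
    (hno : G.NoProperPCUndirStart X Y) {p v m : V} (hp : p ∈ X)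
    (hv : v ∈ D.AnIn Y (Finset.univ \ X)) (hpv : G.dir p v) (hvm : G.UReach v m) :
    G.dir p m := by
  by_contra hpm
  obtain ⟨k₀, hk₀⟩ := hG.exists_frontier hvm hpv hpm
  have hex : ∃ k, ∃ c ∈ D.AnIn Y (Finset.univ \ X), G.Frontier p (k + 1) c :=
    ⟨k₀, v, hv, hk₀⟩
  obtain ⟨c, hcZ, hFc⟩ := Nat.find_spec hex
  have hmin : ∀ j, j < Nat.find hex → ∀ c ∈ D.AnIn Y (Finset.univ \ X),
      ¬ G.Frontier p (j + 1) c :=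
    fun j hj c hc h => Nat.find_min hex hj ⟨c, hc, h⟩
  generalize hr' : Nat.find hex = r' at hFc hmin
  clear hr' hex hk₀ hvm hpm hpv hv
  have hpc : G.dir p c := hFc.1
  have hlev : G.Level p (r' + 1) c := by
    refine ⟨hFc, fun j hj h => ?_⟩
    cases j with
    | zero => exact G.dir_not_undir _ _ hpc h
    | succ j => exact hmin j (by omega) c hcZ h
  obtain ⟨n, hnr, hnlev, hnu⟩ := hlev.exists_walk
  set r := r' + 1 with hr
  have hp0 : G.undir p (n 0) := (hnlev 0 (by omega)).1
  have hpn : ∀ i, 0 < i → i ≤ r → G.dir p (n i) := by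
    intro i hi hir
    cases i with
    | zero => omega
    | succ i => exact (hnlev (i + 1) hir).1.1
  have hstep : ∀ w, G.dir p w → ∀ i ≤ r, G.dir w (n i) →
      ∃ j < i, G.Frontier p (j + 1) w := by
    intro w hpw i hi hwi
    obtain ⟨j, hj, h⟩ := hG.exists_undir_lt hp0 hnu hpw i hi hwi
    exact ⟨j, hj, hpw, n j, (hnlev j (by omega)).1, G.undir_symm _ _ h⟩
  have hback : ∀ i j, i < j → j ≤ r → ¬ G.dir (n j) (n i) := by
    intro i j hij hj h
    obtain ⟨k, hk, hF⟩ := hstep (n j) (hpn j (by omega) hj) i (by omega) h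
    exact (hnlev j hj).2 (k + 1) (by omega) hF
  have hacyc := hD.1.2
  have hpcD := hD.dir_of_dir hpc
  have hdesc : ∀ w ∈ D.AnIn Y (Finset.univ \ X), Relation.TransGen D.dir c w →
      ¬ G.undir p w := by
    intro w hw hcw hpw
    have hDpw : D.dir p w := by
      rcases hD.dir_or_dir (Or.inr (Or.inr hpw)) with h | h
      · exact h
      · exact absurd ((hcw.tail h).tail hpcD) (hacyc c)
    exact G.dir_not_undir _ _ (hD.dir_of_mem_AnIn hno hp hw hDpw) hpw
  have hne : ∀ w ∈ D.AnIn Y (Finset.univ \ X), Relation.TransGen D.dir c w →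
      ∀ i ≤ r, n i ≠ w := by
    rintro w hw hcw i hi rfl
    rcases Nat.lt_or_ge i r with hir | hir
    · cases i with
      | zero => exact hdesc _ hw hcw hp0
      | succ i => exact hmin i (by omega) _ hw (hnlev (i + 1) hi).1
    · obtain rfl : i = r := by omega
      rw [hnr] at hcw
      exact hacyc c hcw
  have hnback : ∀ w ∈ D.AnIn Y (Finset.univ \ X), Relation.TransGen D.dir c w →
      ∀ i ≤ r, ¬ G.dir w (n i) := by
    intro w hw hcw i hi h
    have hwc : ¬ G.dir w (n r) := by
      rw [hnr]
      exact fun h => hacyc c (hcw.tail (hD.dir_of_dir h))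
    have hir : i ≠ r := by
      rintro rfl
      exact hwc h
    obtain ⟨l, hl1, hl2, hl3⟩ := hG.exists_undir_gt hnu hi h hwc
    have hpw : G.dir p w :=
      (hG.dir_or_undir (hpn l (by omega) hl2) (G.undir_symm _ _ hl3)).resolve_right
        (hdesc w hw hcw)
    obtain ⟨j, hj, hF⟩ := hstep w hpw i hi h
    exact hmin j (by omega) w hw hF
  obtain ⟨l, hch, hmem, hend⟩ := exists_path_of_mem_AnIn c hcZ
  have hpwl : (c :: l).Pairwise (Relation.TransGen D.dir) := pairwise_of_isChain_dir hch
  have hcl : ∀ w ∈ l, Relation.TransGen D.dir c w := (List.pairwise_cons.1 hpwl).1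
  have hlZ : ∀ w ∈ l, w ∈ D.AnIn Y (Finset.univ \ X) := fun w hw =>
    hmem w (List.mem_cons_of_mem _ hw)
  have hlX : ∀ w ∈ D.AnIn Y (Finset.univ \ X), w ∉ X := fun w hw => by
    simpa using AnIn_subset _ _ _ hw
  set W : List V := (List.range (r + 1)).map n with hW
  have hmemW : ∀ w ∈ W, ∃ i ≤ r, n i = w := by
    intro w hw
    obtain ⟨i, hi, rfl⟩ := List.mem_map.1 hw
    exact ⟨i, by have := List.mem_range.1 hi; omega, rfl⟩
  have hWlast : W.getLast? = some c := by
    rw [hW, List.range_succ, List.map_append]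
    simp [hnr]
  have hWhead : W.head? = some (n 0) := by
    rw [hW, List.range_succ_eq_map]
    simp
  have hWch : (p :: W).IsChain G.undir := by
    refine List.isChain_cons.2 ⟨fun y hy => ?_, ?_⟩
    · rw [hWhead] at hy
      obtain rfl : n 0 = y := by simpa using hy
      exact hp0
    · rw [hW, List.isChain_map, List.isChain_range_succ]
      exact fun i hi => hnu i hi
  have hall : ((p :: W) ++ l).Pairwise fun u v => u ≠ v ∧ ¬ G.dir v u := by
    refine List.pairwise_append.2 ⟨List.pairwise_cons.2 ⟨fun w hw => ?_, ?_⟩, ?_, ?_⟩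
    · obtain ⟨i, hi, rfl⟩ := hmemW w hw
      cases i with
      | zero =>
        exact ⟨fun h => G.undir_irrefl p (by rw [← h] at hp0; exact hp0),
          fun h => G.dir_not_undir _ _ h (G.undir_symm _ _ hp0)⟩
      | succ i =>
        have := hpn (i + 1) (by omega) hi
        exact ⟨fun h => G.dir_irrefl p (by rw [← h] at this; exact this),
          G.dir_asymm _ _ this⟩
    · refine List.pairwise_map.2 (List.Pairwise.imp_of_mem ?_ List.pairwise_lt_range)
      intro i j hi hj hij
      have hi := List.mem_range.1 hi
      have hj := List.mem_range.1 hj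
      refine ⟨fun h => ?_, hback i j hij (by omega)⟩
      have h1 := hnlev i (by omega)
      rw [h] at h1
      have := h1.unique (hnlev j (by omega))
      omega
    · refine (List.pairwise_cons.1 hpwl).2.imp fun {u v} h => ⟨?_, fun h' => ?_⟩
      · rintro rfl
        exact hacyc _ h
      · exact hacyc _ (h.tail (hD.dir_of_dir h'))
    · intro u hu w hw
      rcases List.mem_cons.1 hu with rfl | hu
      · refine ⟨?_, fun h => ?_⟩
        · rintro rfl
          exact hlX _ (hlZ _ hw) hp
        · exact hacyc c (((hcl w hw).tail (hD.dir_of_dir h)).tail hpcD)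
      · obtain ⟨i, hi, rfl⟩ := hmemW u hu
        exact ⟨hne w (hlZ w hw) (hcl w hw) i hi, hnback w (hlZ w hw) (hcl w hw) i hi⟩
  have hWlast' : (p :: W).getLast? = some c := by
    simp [List.getLast?_cons, hWlast]
  obtain ⟨q, b, l', hsuf, hq, hl'⟩ := exists_suffix_of_mem (X := X) (p :: W)
    ⟨p, by simp, hp⟩ (fun c' hc' => by
      rw [hWlast'] at hc'
      obtain rfl : c = c' := by simpa using hc'
      exact hlX c hcZ)
  have hsuf' : (q :: b :: l') ++ l <:+ (p :: W) ++ l := by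
    obtain ⟨t, ht⟩ := hsuf
    exact ⟨t, by rw [← List.append_assoc, ht]⟩
  have hqch := hWch.suffix hsuf
  have hqlast : (q :: b :: l').getLast? = some c := by
    obtain ⟨t, ht⟩ := hsuf
    rw [← hWlast', ← ht, List.getLast?_append_of_ne_nil _ (by simp)]
  refine hno.false_of_list (l := l' ++ l) hq (List.isChain_cons_cons.1 hqch).1 ?_ ?_
    (hall.sublist hsuf'.sublist) ?_
  · intro w hw
    rw [← List.cons_append] at hw
    rcases List.mem_append.1 hw with hw | hw
    · exact hl' w hw
    · exact hlX w (hlZ w hw)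
  · have : ((q :: b :: l') ++ l).IsChain G.Adj := by
      refine List.isChain_append.2 ⟨hqch.imp fun _ _ h => Or.inr (Or.inr h),
        (List.isChain_cons.1 hch).2.imp fun _ _ h => hD.adj_of_dir h, ?_⟩
      intro u hu w hw
      rw [hqlast] at hu
      obtain rfl : c = u := by simpa using hu
      exact hD.adj_of_dir ((List.isChain_cons.1 hch).1 w hw)
    exact this
  · obtain ⟨e, he, hle⟩ := hend
    refine ⟨e, he, ?_⟩
    have : ((q :: b :: l') ++ l).getLast? = some e := by
      rw [List.getLast?_append, hqlast, ← hle]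
      cases l with
      | nil => simp
      | cons a l => simp [List.getLast?_cons]
    exact this

end Fin

end PDG

section Independence

variable {V Ω : Type}

/-- `F` does not depend on the coordinates in `S`. -/
def IndepOf (S : Finset V) (F : (V → Ω) → ℝ) : Prop :=
  ∀ g h : V → Ω, (∀ v, v ∉ S → g v = h v) → F g = F h

lemma IndepOf.prod {ι : Type*} {S : Finset V} {I : Finset ι} {F : ι → (V → Ω) → ℝ}
    (hF : ∀ i ∈ I, IndepOf S (F i)) : IndepOf S fun h => ∏ i ∈ I, F i h :=
  fun g h hgh => Finset.prod_congr rfl fun i hi => hF i hi g h hgh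

end Independence

section Density

open PDG

variable {V : Type} [Fintype V] [DecidableEq V] {Ω : Type} [Fintype Ω] [DecidableEq Ω]

/-- the sum of `F` over all values of the coordinates in `S`, the other ones being given
by `g`. -/
def sumOver (S : Finset V) (F : (V → Ω) → ℝ) (g : V → Ω) : ℝ :=
  ∑ h : V → Ω, if ∀ v, v ∉ S → h v = g v then F h else 0

lemma sumOver_empty (F : (V → Ω) → ℝ) : sumOver ∅ F = F := by
  funext g
  rw [sumOver, Finset.sum_eq_single g]
  · simp
  · intro h _ hne
    rw [if_neg]
    exact fun hh => hne (funext fun v => hh v (by simp))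
  · simp

lemma sumOver_union {S T : Finset V} (hST : Disjoint S T) (F : (V → Ω) → ℝ) :
    sumOver (S ∪ T) F = sumOver S (sumOver T F) := by
  funext g
  have h1 : sumOver S (sumOver T F) g = ∑ k : V → Ω, ∑ h : V → Ω,
      if (∀ v, v ∉ S → h v = g v) ∧ (∀ v, v ∉ T → k v = h v) then F k else 0 := by
    rw [Finset.sum_comm]
    refine Finset.sum_congr rfl fun h _ => ?_
    by_cases hh : ∀ v, v ∉ S → h v = g v
    · rw [if_pos hh]
      exact Finset.sum_congr rfl fun k _ => if_congr (by tauto) rfl rfl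
    · rw [if_neg hh, Finset.sum_eq_zero fun k _ => if_neg (by tauto)]
  rw [h1, sumOver]
  refine Finset.sum_congr rfl fun k _ => ?_
  rw [Finset.sum_eq_single (fun v => if v ∈ S then k v else g v)]
  · refine if_congr ⟨fun h => ⟨fun v hv => if_neg hv, fun v hv => ?_⟩, fun h v hv => ?_⟩ rfl rfl
    · by_cases hvS : v ∈ S
      · simp [hvS]
      · simp [hvS, h v (by simp [hvS, hv])]
    · simp only [Finset.mem_union, not_or] at hv
      simpa [hv.1] using h.2 v hv.2
  · intro h _ hne
    rw [if_neg]
    rintro ⟨hh1, hh2⟩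
    refine hne (funext fun v => ?_)
    by_cases hvS : v ∈ S
    · simp [hvS, hh2 v (Finset.disjoint_left.1 hST hvS)]
    · simp [hvS, hh1 v hvS]
  · simp

lemma sumOver_congr {S : Finset V} {F F' : (V → Ω) → ℝ} {g : V → Ω}
    (h : ∀ k, (∀ v, v ∉ S → k v = g v) → F k = F' k) : sumOver S F g = sumOver S F' g := by
  refine Finset.sum_congr rfl fun k _ => ?_
  split_ifs with hk
  · exact h k hk
  · rfl

lemma sumOver_mul {S : Finset V} {F : (V → Ω) → ℝ} (hF : IndepOf S F) (F' : (V → Ω) → ℝ) :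
    sumOver S (fun h => F h * F' h) = fun g => F g * sumOver S F' g := by
  funext g
  rw [sumOver, sumOver, Finset.mul_sum]
  refine Finset.sum_congr rfl fun h _ => ?_
  split_ifs with hh
  · rw [hF h g hh]
  · simp

lemma margin_eq_sumOver (f : (V → Ω) → ℝ) (S : Finset V) : margin f S = sumOver Sᶜ f := by
  funext g
  exact Finset.sum_congr rfl fun h _ => if_congr (by simp) rfl rfl

lemma margin_pos {f : (V → Ω) → ℝ} (hf : ∀ g, 0 < f g) (S : Finset V) (g : V → Ω) :
    0 < margin f S g := by
  refine Finset.sum_pos' (fun h _ => ?_) ⟨g, Finset.mem_univ _, ?_⟩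
  · split_ifs
    · exact (hf h).le
    · exact le_rfl
  · simpa using hf g

lemma indepOf_margin (f : (V → Ω) → ℝ) {S T : Finset V} (h : Disjoint S T) :
    IndepOf S (margin f T) := fun g g' hg => by
  refine Finset.sum_congr rfl fun k _ => if_congr ?_ rfl rfl
  refine forall₂_congr fun v hv => ?_
  rw [hg v (Finset.disjoint_right.1 h hv)]

lemma indepOf_condOn (f : (V → Ω) → ℝ) {S A B : Finset V} (h : Disjoint S (A ∪ B)) :
    IndepOf S (condOn f A B) := fun g g' hg => by
  rw [condOn, condOn, indepOf_margin f h g g' hg,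
    indepOf_margin f (h.mono_right Finset.subset_union_right) g g' hg]

lemma sumOver_margin (f : (V → Ω) → ℝ) {S T : Finset V} (h : Disjoint S T) :
    sumOver S (margin f (S ∪ T)) = margin f T := by
  rw [margin_eq_sumOver, ← sumOver_union, margin_eq_sumOver]
  · congr 1
    ext v
    have : v ∈ S → v ∉ T := fun hv => Finset.disjoint_left.1 h hv
    simp only [Finset.mem_union, Finset.mem_compl]
    tauto
  · rw [Finset.disjoint_left]
    intro v hv
    simp [hv]

lemma sumOver_condOn (f : (V → Ω) → ℝ) {S T Q : Finset V} (h : Disjoint S (T ∪ Q)) :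
    sumOver S (condOn f (S ∪ T) Q) = condOn f T Q := by
  have h1 : condOn f (S ∪ T) Q = fun g => (margin f Q g)⁻¹ * margin f (S ∪ (T ∪ Q)) g := by
    funext g
    rw [condOn, div_eq_inv_mul, Finset.union_assoc]
  have hQ : IndepOf S fun g => (margin f Q g)⁻¹ := fun g g' hg =>
    congrArg _ (indepOf_margin f (h.mono_right Finset.subset_union_right) g g' hg)
  rw [h1, sumOver_mul hQ, sumOver_margin f h]
  funext g
  rw [condOn, div_eq_inv_mul]

lemma sumOver_condOn_self {f : (V → Ω) → ℝ} (hf : ∀ g, 0 < f g) {S Q : Finset V}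
    (h : Disjoint S Q) : sumOver S (condOn f S Q) = fun _ => 1 := by
  have := sumOver_condOn f (S := S) (T := ∅) (Q := Q) (by simpa using h)
  rw [Finset.union_empty] at this
  rw [this]
  funext g
  rw [condOn, Finset.empty_union, div_self (margin_pos hf Q g).ne']

lemma indepOf_condOn_paFin (f : (V → Ω) → ℝ) {D : PDG V} {S : Finset V} {v : V}
    (hv : v ∉ S) (h : ∀ u ∈ S, ¬ D.dir u v) : IndepOf S (condOn f {v} (D.paFin v)) := by
  refine indepOf_condOn f (Finset.disjoint_left.2 fun u hu hu' => ?_)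
  rcases Finset.mem_union.1 hu' with hu' | hu'
  · exact hv (Finset.mem_singleton.1 hu' ▸ hu)
  · exact h u hu (mem_paFin.1 hu')

/-- Nodes without children outside the set being summed out can be summed out of a product
of conditional densities. -/
lemma sumOver_prod_condOn {f : (V → Ω) → ℝ} (hf : ∀ g, 0 < f g) {D : PDG V}
    (hD : D.Acyclic) {R : Finset V} (N : Finset V) (hRN : Disjoint R N)
    (h : ∀ u ∈ N, ∀ v ∈ R, ¬ D.dir u v) :
    sumOver N (fun g => ∏ v ∈ R ∪ N, condOn f {v} (D.paFin v) g) =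
      fun g => ∏ v ∈ R, condOn f {v} (D.paFin v) g := by
  induction hn : N.card generalizing N with
  | zero =>
    obtain rfl := Finset.card_eq_zero.1 hn
    rw [sumOver_empty, Finset.union_empty]
  | succ n ih =>
    obtain ⟨v, hv, hsink⟩ := hD.exists_sink (Finset.card_pos.1 (by omega : 0 < N.card))
    have hN : N = N.erase v ∪ {v} := by
      ext w
      by_cases hw : w = v <;> simp [hw, hv]
    have hdis : Disjoint (N.erase v) {v} := by simp
    have hvR : v ∉ R := Finset.disjoint_right.1 hRN hv
    have key : sumOver {v} (fun g => ∏ w ∈ R ∪ N, condOn f {w} (D.paFin w) g) =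
        fun g => ∏ w ∈ R ∪ N.erase v, condOn f {w} (D.paFin w) g := by
      have hU : R ∪ N = insert v (R ∪ N.erase v) := by
        ext w
        by_cases hw : w = v <;> simp [hw, hv]
      have hvU : v ∉ R ∪ N.erase v := by simp [hvR]
      simp_rw [hU, Finset.prod_insert hvU, mul_comm (condOn f {v} (D.paFin v) _)]
      rw [sumOver_mul, sumOver_condOn_self hf]
      · simp
      · simp [mem_paFin, D.dir_irrefl]
      · refine IndepOf.prod fun w hw => indepOf_condOn_paFin f ?_ ?_
        · rw [Finset.mem_singleton]
          rintro rfl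
          exact hvU hw
        · intro u hu
          obtain rfl := Finset.mem_singleton.1 hu
          rcases Finset.mem_union.1 hw with hw | hw
          · exact h u hv w hw
          · exact fun huw => hsink w (Finset.mem_of_mem_erase hw) (.single huw)
    rw [hN, sumOver_union hdis, ← hN, key]
    refine ih (N.erase v) (hRN.mono_right (Finset.erase_subset _ _))
      (fun u hu => h u (Finset.mem_of_mem_erase hu)) ?_
    rw [Finset.card_erase_of_mem hv, hn, Nat.add_sub_cancel]

/-- The marginal over a set which is closed under parents factorizes. -/
lemma margin_eq_prod {f : (V → Ω) → ℝ} (hf : ∀ g, 0 < f g) {D : PDG V} (hD : D.Acyclic)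
    (hcons : ConsistentWith f D) {R : Finset V} (h : ∀ u v, D.dir u v → v ∈ R → u ∈ R)
    (g : V → Ω) : margin f R g = ∏ v ∈ R, condOn f {v} (D.paFin v) g := by
  rw [margin_eq_sumOver, ← congrFun (sumOver_prod_condOn hf hD Rᶜ disjoint_compl_right
    fun u hu v hv huv => Finset.mem_compl.1 hu (h u v huv hv)) g]
  rw [Finset.union_compl]
  exact congrFun (congrArg _ (funext hcons)) g

/-- The local Markov property. -/
lemma margin_insert {f : (V → Ω) → ℝ} (hf : ∀ g, 0 < f g) {D : PDG V} (hD : D.Acyclic)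
    (hcons : ConsistentWith f D) {S : Finset V} {v : V} (hvS : v ∉ S)
    (hpa : ∀ u, D.dir u v → u ∈ S) (hS : ∀ u ∈ S, ¬ Relation.TransGen D.dir v u)
    (g : V → Ω) :
    margin f (insert v S) g = condOn f {v} (D.paFin v) g * margin f S g := by
  set R : Finset V := Finset.univ.filter fun u => u ≠ v ∧ ¬ Relation.TransGen D.dir v u
    with hR
  have hvR : v ∉ R := by simp [hR]
  have hSR : S ⊆ R := fun u hu => by
    simp only [hR, Finset.mem_filter, Finset.mem_univ, true_and]
    exact ⟨fun h => hvS (h ▸ hu), hS u hu⟩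
  have hRcl : ∀ u w, D.dir u w → w ∈ R → u ∈ R := by
    simp only [hR, Finset.mem_filter, Finset.mem_univ, true_and]
    rintro u w huw ⟨h1, h2⟩
    refine ⟨?_, fun h => h2 (h.tail huw)⟩
    rintro rfl
    exact h2 (.single huw)
  have hRcl' : ∀ u w, D.dir u w → w ∈ insert v R → u ∈ insert v R := by
    intro u w huw hw
    rcases Finset.mem_insert.1 hw with rfl | hw
    · exact Finset.mem_insert_of_mem (hSR (hpa u huw))
    · exact Finset.mem_insert_of_mem (hRcl u w huw hw)
  have hprod : margin f (insert v R) =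
      fun g => condOn f {v} (D.paFin v) g * margin f R g := by
    funext g
    rw [margin_eq_prod hf hD hcons hRcl', Finset.prod_insert hvR,
      margin_eq_prod hf hD hcons hRcl]
  have h1 := sumOver_margin f (S := R \ S) (T := insert v S) (by
    rw [Finset.disjoint_left]
    intro u hu hu'
    rw [Finset.mem_sdiff] at hu
    rcases Finset.mem_insert.1 hu' with rfl | hu'
    · exact hvR hu.1
    · exact hu.2 hu')
  have h2 := sumOver_margin f (S := R \ S) (T := S) Finset.sdiff_disjoint
  rw [Finset.sdiff_union_of_subset hSR] at h2
  rw [Finset.union_insert, Finset.sdiff_union_of_subset hSR, hprod, sumOver_mul, h2] at h1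
  · exact (congrFun h1 g).symm
  · refine indepOf_condOn_paFin f (fun h => hvR (Finset.mem_sdiff.1 h).1) ?_
    exact fun u hu huv => (Finset.mem_sdiff.1 hu).2 (hpa u huv)

/-- If all nodes of `T` have the same parents `Q` outside of `T`, then the product of their
conditional densities is the conditional density of `T` given `Q`. -/
lemma prod_condOn_paFin {f : (V → Ω) → ℝ} (hf : ∀ g, 0 < f g) {D : PDG V} (hD : D.Acyclic)
    (hcons : ConsistentWith f D) {T Q : Finset V} (hTQ : Disjoint T Q)
    (h1 : ∀ q ∈ Q, ∀ v ∈ T, D.dir q v) (h2 : ∀ v ∈ T, ∀ u, D.dir u v → u ∈ T ∪ Q)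
    (g : V → Ω) : ∏ v ∈ T, condOn f {v} (D.paFin v) g = condOn f T Q g := by
  rw [condOn, eq_div_iff (margin_pos hf Q g).ne']
  induction hn : T.card generalizing T with
  | zero =>
    obtain rfl := Finset.card_eq_zero.1 hn
    simp
  | succ n ih =>
    obtain ⟨v, hv, hsink⟩ := hD.exists_sink (Finset.card_pos.1 (by omega : 0 < T.card))
    have hvQ : v ∉ Q := Finset.disjoint_left.1 hTQ hv
    have hu : T ∪ Q = insert v (T.erase v ∪ Q) := by
      rw [← Finset.insert_union, Finset.insert_erase hv]
    rw [hu, margin_insert hf hD hcons, ← ih (T := T.erase v), ← mul_assoc,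
      Finset.mul_prod_erase T (fun v => condOn f {v} (D.paFin v) g) hv]
    · exact hTQ.mono_left (Finset.erase_subset _ _)
    · exact fun q hq w hw => h1 q hq w (Finset.mem_of_mem_erase hw)
    · intro w hw u huw
      have hw' := Finset.mem_of_mem_erase hw
      have := h2 w hw' u huw
      rw [hu] at this
      refine (Finset.mem_insert.1 this).resolve_left ?_
      rintro rfl
      exact hsink w hw' (.single huw)
    · rw [Finset.card_erase_of_mem hv, hn, Nat.add_sub_cancel]
    · simp [hvQ]
    · intro u huv
      have := h2 v hv u huv
      rw [hu] at this
      refine (Finset.mem_insert.1 this).resolve_left ?_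
      rintro rfl
      exact D.dir_irrefl _ huv
    · intro u hu' hvu
      rcases Finset.mem_union.1 hu' with hu' | hu'
      · exact hsink u (Finset.mem_of_mem_erase hu') hvu
      · exact hD v (hvu.tail (h1 u hu' v hv))

/-- Summing disjoint blocks of coordinates out of a product of conditional densities. -/
lemma sumOver_biUnion_prod_condOn {ι : Type*} (f : (V → Ω) → ℝ) (I : Finset ι)
    {W B Q : ι → Finset V} (hWB : ∀ i ∈ I, ∀ j ∈ I, Disjoint (W i) (B j))
    (hWQ : ∀ i ∈ I, ∀ j ∈ I, Disjoint (W i) (Q j))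
    (hWW : ∀ i ∈ I, ∀ j ∈ I, i ≠ j → Disjoint (W i) (W j)) :
    sumOver (I.biUnion W) (fun g => ∏ i ∈ I, condOn f (W i ∪ B i) (Q i) g) =
      fun g => ∏ i ∈ I, condOn f (B i) (Q i) g := by
  suffices H : ∀ J ⊆ I, sumOver (J.biUnion W)
      (fun g => ∏ i ∈ J, condOn f (W i ∪ B i) (Q i) g) =
      fun g => ∏ i ∈ J, condOn f (B i) (Q i) g from H I subset_rfl
  intro J
  induction J using Finset.induction_on with
  | empty =>
    intro _
    rw [Finset.biUnion_empty, sumOver_empty]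
    simp
  | insert i J hiJ ih =>
    intro hJ
    have hi : i ∈ I := hJ (Finset.mem_insert_self _ _)
    have hJ' : ∀ j ∈ J, j ∈ I := fun j hj => hJ (Finset.mem_insert_of_mem hj)
    have hne : ∀ j ∈ J, i ≠ j := fun j hj h => hiJ (h ▸ hj)
    have hW : Disjoint (W i) (J.biUnion W) := by
      rw [Finset.disjoint_biUnion_right]
      exact fun j hj => hWW i hi j (hJ' j hj) (hne j hj)
    simp_rw [Finset.prod_insert hiJ]
    rw [Finset.biUnion_insert, sumOver_union hW, sumOver_mul, ih fun j hj => hJ' j hj]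
    · simp_rw [mul_comm (condOn f (W i ∪ B i) (Q i) _), mul_comm (condOn f (B i) (Q i) _)]
      rw [sumOver_mul, sumOver_condOn]
      · rw [Finset.disjoint_union_right]
        exact ⟨hWB i hi i hi, hWQ i hi i hi⟩
      · refine IndepOf.prod fun j hj => indepOf_condOn f ?_
        rw [Finset.disjoint_union_right]
        exact ⟨hWB i hi j (hJ' j hj), hWQ i hi j (hJ' j hj)⟩
    · refine indepOf_condOn f ?_
      rw [Finset.disjoint_biUnion_left]
      intro j hj
      rw [Finset.disjoint_union_right, Finset.disjoint_union_right]
      exact ⟨⟨hWW j (hJ' j hj) i hi (hne j hj).symm, hWB j (hJ' j hj) i hi⟩,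
        hWQ j (hJ' j hj) i hi⟩

end Density

namespace PDG

section Blocks

variable {V : Type} {G D : PDG V}

/-- The nodes of `Z` which are reachable from `B` along undirected edges. -/
def reachIn (G : PDG V) (Z B : Finset V) : Finset V := Z.filter fun v => ∃ b ∈ B, G.UReach b v

lemma mem_reachIn {Z B : Finset V} {v : V} :
    v ∈ G.reachIn Z B ↔ v ∈ Z ∧ ∃ b ∈ B, G.UReach b v := by
  simp [reachIn]

lemma Bucket.eq_of_ureach {B B' S : Finset V} (hB : G.Bucket B S) (hB' : G.Bucket B' S)
    {b b' : V} (hb : b ∈ B) (hb' : b' ∈ B') (h : G.UReach b b') : B = B' := by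
  ext a
  rw [hB.mem_iff hb, hB'.mem_iff hb']
  exact and_congr_right fun _ => ⟨h.symm.trans, h.trans⟩

variable [DecidableEq V]

lemma mem_foldr_union {Bs : List (Finset V)} {v : V} :
    v ∈ Bs.foldr (· ∪ ·) ∅ ↔ ∃ B ∈ Bs, v ∈ B := by
  induction Bs with
  | nil => simp
  | cons B Bs ih => simp [ih]

lemma IsBucketDecompList.nodup {S : Finset V} {Bs : List (Finset V)}
    (h : G.IsBucketDecompList S Bs) : Bs.Nodup := by
  refine h.2.1.imp_of_mem fun {B B'} hB _ hd hBB' => ?_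
  subst hBB'
  exact (h.1 B hB).1.ne_empty (disjoint_self.1 hd)

variable [Fintype V] {X Y B : Finset V}

lemma mem_PaFin {B : Finset V} {u : V} : u ∈ G.PaFin B ↔ (∃ b ∈ B, G.dir u b) ∧ u ∉ B := by
  simp [PaFin]

lemma PaFin_subset (hB : G.Bucket B (G.AnIn Y (Finset.univ \ X))) :
    G.PaFin B ⊆ X ∪ G.AnIn Y (Finset.univ \ X) := by
  intro q hq
  obtain ⟨⟨b, hb, hqb⟩, -⟩ := mem_PaFin.1 hq
  rw [Finset.mem_union]
  by_cases hqX : q ∈ X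
  · exact Or.inl hqX
  · exact Or.inr (mem_AnIn_of_dir (hB.2.1 hb) hqb (by simpa using hqX))

lemma dir_of_mem_PaFin (hG : G.IsMPDAG) (hD : D.InClassOf G)
    (hno : G.NoProperPCUndirStart X Y) (hB : G.Bucket B (G.AnIn Y (Finset.univ \ X)))
    {q v : V} (hq : q ∈ G.PaFin B)
    (hv : v ∈ G.reachIn (D.AnIn Y (Finset.univ \ X)) B) : G.dir q v := by
  have hqXA := PaFin_subset hB hq
  obtain ⟨⟨b, hb, hqb⟩, hqB⟩ := mem_PaFin.1 hq
  obtain ⟨-, b', hb', hbv⟩ := mem_reachIn.1 hv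
  have hbv : G.UReach b v := (hB.2.2.1.ureach hb hb').trans hbv
  rcases Finset.mem_union.1 hqXA with hqX | hqA
  · exact hD.dir_of_ureach hG hno hqX
      (AnIn_mono (fun _ _ => hD.dir_of_dir) _ _ (hB.2.1 hb)) hqb hbv
  · refine (hG.dir_or_ureach hqb hbv).resolve_right fun h => hqB ?_
    exact (hB.mem_iff hb q).2 ⟨hqA, hbv.trans h.symm⟩

lemma mem_of_dir_reachIn (hG : G.IsMPDAG) (hD : D.InClassOf G)
    (hno : G.NoProperPCUndirStart X Y) (hB : G.Bucket B (G.AnIn Y (Finset.univ \ X)))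
    {u v : V} (hv : v ∈ G.reachIn (D.AnIn Y (Finset.univ \ X)) B) (huv : D.dir u v) :
    u ∈ G.reachIn (D.AnIn Y (Finset.univ \ X)) B ∪ G.PaFin B := by
  obtain ⟨hvZ, b, hb, hbv⟩ := mem_reachIn.1 hv
  rw [Finset.mem_union, mem_reachIn, mem_PaFin]
  by_cases huX : u ∈ X
  · have h := hD.dir_of_ureach hG hno huX hvZ (hD.dir_of_mem_AnIn hno huX hvZ huv) hbv.symm
    refine Or.inr ⟨⟨b, hb, h⟩, fun huB => ?_⟩
    have := AnIn_subset _ _ _ (hB.2.1 huB)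
    simp [huX] at this
  · have huZ : u ∈ D.AnIn Y (Finset.univ \ X) :=
      mem_AnIn_of_dir hvZ huv (by simpa using huX)
    rcases hD.dir_or_undir huv with h | h
    · rcases hG.dir_or_ureach h hbv.symm with h | h
      · by_cases huB : u ∈ B
        · exact Or.inl ⟨huZ, u, huB, Relation.ReflTransGen.refl⟩
        · exact Or.inr ⟨⟨b, hb, h⟩, huB⟩
      · exact Or.inl ⟨huZ, b, hb, h.symm⟩
    · exact Or.inl ⟨huZ, b, hb, hbv.tail (G.undir_symm _ _ h)⟩

end Blocks

end PDG

open PDG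

/-- the causal identification formula. -/
theorem stmt1 {V : Type} [Fintype V] [DecidableEq V]
    {Ω : Type} [Fintype Ω] [DecidableEq Ω]
    (G : PDG V) (hG : G.IsMPDAG) (X Y : Finset V) (hXY : Disjoint X Y)
    (hno : G.NoProperPCUndirStart X Y)
    (Bs : List (Finset V)) (hk : Bs ≠ [])
    (hdec : G.IsBucketDecompList (G.AnIn Y (Finset.univ \ X)) Bs)
    (hord : G.OrderedDecomp Bs)
    (D : PDG V) (hD : D.InClassOf G)
    (f : (V → Ω) → ℝ) (hf : IsPosDensity f) (hcons : ConsistentWith f D)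
    (x y g₀ : V → Ω) :
    doMargin f D X x Y y =
      ∑ g : V → Ω,
        if (∀ v ∈ X, g v = x v) ∧ (∀ v ∈ Y, g v = y v) ∧
            (∀ v, v ∉ X → v ∉ Y → v ∉ G.AnIn Y (Finset.univ \ X) \ Y → g v = g₀ v)
        then (Bs.map fun Bi => condOn f Bi (G.PaFin Bi) g).prod
        else 0 := by
  set A : Finset V := G.AnIn Y (Finset.univ \ X) with hA
  set Z : Finset V := D.AnIn Y (Finset.univ \ X) with hZ
  set N : Finset V := Finset.univ \ (X ∪ Z) with hN
  have hacyc := hD.1.2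
  have hbucket : ∀ B ∈ Bs.toFinset, G.Bucket B A := fun B hB => hdec.1 B (List.mem_toFinset.1 hB)
  have hAZ : A ⊆ Z := AnIn_mono (fun _ _ => hD.dir_of_dir) _ _
  have hZX : ∀ v ∈ Z, v ∉ X := fun v hv => by simpa using AnIn_subset _ _ _ hv
  have hYA : ∀ v ∈ Y, v ∈ A := fun v hv =>
    mem_AnIn_self hv (by simpa using Finset.disjoint_right.1 hXY hv)
  have hcover : Bs.toFinset.biUnion (G.reachIn Z) = Z := by
    ext v
    simp only [Finset.mem_biUnion, mem_reachIn]
    refine ⟨fun ⟨_, _, h, _⟩ => h, fun hv => ?_⟩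
    obtain ⟨a, ha, hva⟩ := hD.exists_ureach hG v hv
    have haF : a ∈ Bs.foldr (· ∪ ·) ∅ := by rw [hdec.2.2]; exact ha
    obtain ⟨B, hB, haB⟩ := mem_foldr_union.1 haF
    exact ⟨B, List.mem_toFinset.2 hB, hv, a, haB, hva.symm⟩
  have hdisj : ∀ B ∈ Bs.toFinset, ∀ B' ∈ Bs.toFinset, B ≠ B' →
      Disjoint (G.reachIn Z B) (G.reachIn Z B') := by
    intro B hB B' hB' hne
    rw [Finset.disjoint_left]
    intro v hv hv'
    obtain ⟨-, b, hb, hbv⟩ := mem_reachIn.1 hv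
    obtain ⟨-, b', hb', hbv'⟩ := mem_reachIn.1 hv'
    exact hne ((hbucket B hB).eq_of_ureach (hbucket B' hB') hb hb' (hbv.trans hbv'.symm))
  have hsplit : ∀ B ∈ Bs.toFinset, G.reachIn Z B = G.reachIn Z B \ A ∪ B := by
    intro B hB
    have hBA := (hbucket B hB).2.1
    ext v
    rw [Finset.mem_union, Finset.mem_sdiff]
    refine ⟨fun hv => ?_, fun hv => hv.elim And.left fun hv =>
      mem_reachIn.2 ⟨hAZ (hBA hv), v, hv, Relation.ReflTransGen.refl⟩⟩
    by_cases hvA : v ∈ A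
    · obtain ⟨-, b, hb, hbv⟩ := mem_reachIn.1 hv
      exact Or.inr (((hbucket B hB).mem_iff hb v).2 ⟨hvA, hbv⟩)
    · exact Or.inl ⟨hv, hvA⟩
  have hblocks : (fun g => ∏ v ∈ Z, condOn f {v} (D.paFin v) g) =
      fun g => ∏ B ∈ Bs.toFinset, condOn f (G.reachIn Z B \ A ∪ B) (G.PaFin B) g := by
    funext g
    conv_lhs => rw [← hcover]
    rw [Finset.prod_biUnion fun B hB B' hB' hne => hdisj B hB B' hB' hne]
    refine Finset.prod_congr rfl fun B hB => ?_
    rw [← hsplit B hB]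
    refine prod_condOn_paFin hf.1 hacyc hcons (Finset.disjoint_left.2 fun v hv hv' => ?_)
      (fun q hq v hv => ?_) (fun v hv u huv => ?_) g
    · exact G.dir_irrefl v (dir_of_mem_PaFin hG hD hno (hbucket B hB) hv' hv)
    · exact hD.dir_of_dir (dir_of_mem_PaFin hG hD hno (hbucket B hB) hq hv)
    · exact mem_of_dir_reachIn hG hD hno (hbucket B hB) hv huv
  have hW : Bs.toFinset.biUnion (fun B => G.reachIn Z B \ A) = Z \ A := by
    conv_rhs => rw [← hcover]
    ext v
    simp only [Finset.mem_biUnion, Finset.mem_sdiff]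
    exact ⟨fun ⟨B, h1, h2, h3⟩ => ⟨⟨B, h1, h2⟩, h3⟩, fun ⟨⟨B, h1, h2⟩, h3⟩ => ⟨B, h1, h2, h3⟩⟩
  have hsumW : sumOver (Z \ A) (fun g => ∏ v ∈ Z, condOn f {v} (D.paFin v) g) =
      fun g => (Bs.map fun B => condOn f B (G.PaFin B) g).prod := by
    rw [hblocks, ← hW, sumOver_biUnion_prod_condOn]
    · funext g
      exact List.prod_toFinset (fun B => condOn f B (G.PaFin B) g) hdec.nodup
    · intro B _ B' hB'
      exact Finset.sdiff_disjoint.mono_right (hbucket B' hB').2.1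
    · intro B _ B' hB'
      refine Disjoint.mono_right (PaFin_subset (hbucket B' hB')) ?_
      rw [Finset.disjoint_left]
      intro v hv hv'
      rw [Finset.mem_sdiff, mem_reachIn] at hv
      rcases Finset.mem_union.1 hv' with h | h
      · exact hZX v hv.1.1 h
      · exact hv.2 h
    · intro B hB B' hB' hne
      exact (hdisj B hB B' hB' hne).mono Finset.sdiff_subset Finset.sdiff_subset
  have hsumN : sumOver N (fun g => ∏ v ∈ Finset.univ \ X, condOn f {v} (D.paFin v) g) =
      fun g => ∏ v ∈ Z, condOn f {v} (D.paFin v) g := by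
    have hU : Finset.univ \ X = Z ∪ N := by
      ext v
      have := hZX v
      simp only [hN, Finset.mem_sdiff, Finset.mem_univ, true_and, Finset.mem_union]
      tauto
    rw [hU]
    refine sumOver_prod_condOn hf.1 hacyc N ?_ ?_
    · rw [Finset.disjoint_left]
      intro v hv hvN
      simp [hN, hv] at hvN
    · intro u hu v hv huv
      simp only [hN, Finset.mem_sdiff, Finset.mem_univ, true_and, Finset.mem_union,
        not_or] at hu
      exact hu.2 (mem_AnIn_of_dir hv huv (by simpa using hu.1))
  set g₁ : V → Ω := fun v => if v ∈ X then x v else if v ∈ Y then y v else g₀ v with hg₁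
  have hg₁X : ∀ v ∈ X, g₁ v = x v := fun v hv => by simp [hg₁, hv]
  have hg₁Y : ∀ v ∈ Y, g₁ v = y v := fun v hv => by
    simp [hg₁, hv, Finset.disjoint_right.1 hXY hv]
  have hg₁0 : ∀ v, v ∉ X → v ∉ Y → g₁ v = g₀ v := fun v hv hv' => by simp [hg₁, hv, hv']
  have hU : Finset.univ \ (X ∪ Y) = A \ Y ∪ (Z \ A ∪ N) := by
    ext v
    have h1 := hZX v
    have h2 := hYA v
    have h3 : v ∈ A → v ∈ Z := fun h => hAZ h
    simp only [hN, Finset.mem_sdiff, Finset.mem_univ, true_and, Finset.mem_union]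
    tauto
  have hdisj1 : Disjoint (A \ Y) (Z \ A ∪ N) := by
    rw [Finset.disjoint_left]
    intro v hv hv'
    have h3 : v ∈ A → v ∈ Z := fun h => hAZ h
    simp only [hN, Finset.mem_sdiff, Finset.mem_univ, true_and, Finset.mem_union] at hv hv'
    tauto
  have hdisj2 : Disjoint (Z \ A) N := by
    rw [Finset.disjoint_left]
    intro v hv hv'
    simp only [hN, Finset.mem_sdiff, Finset.mem_univ, true_and, Finset.mem_union] at hv hv'
    tauto
  have hleft : doMargin f D X x Y y = sumOver (Finset.univ \ (X ∪ Y)) (doDens f D X x) g₁ := by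
    refine Finset.sum_congr rfl fun g _ => if_congr ⟨fun h v hv => ?_, fun h => ⟨?_, ?_⟩⟩ rfl rfl
    · simp only [Finset.mem_sdiff, Finset.mem_univ, true_and, not_not, Finset.mem_union] at hv
      rcases hv with hv | hv
      · rw [h.1 v hv, hg₁X v hv]
      · rw [h.2 v hv, hg₁Y v hv]
    · exact fun v hv => (h v (by simp [hv])).trans (hg₁X v hv)
    · exact fun v hv => (h v (by simp [hv])).trans (hg₁Y v hv)
  have hdo : sumOver (Finset.univ \ (X ∪ Y)) (doDens f D X x) g₁ =
      sumOver (Finset.univ \ (X ∪ Y))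
        (fun g => ∏ v ∈ Finset.univ \ X, condOn f {v} (D.paFin v) g) g₁ := by
    refine sumOver_congr fun k hk => Finset.prod_congr rfl fun v _ => ?_
    congr 1
    funext u
    split_ifs with hu
    · rw [hk u (by simp [hu]), hg₁X u hu]
    · rfl
  rw [hleft, hdo, hU, sumOver_union hdisj1, sumOver_union hdisj2, hsumN, hsumW]
  refine Finset.sum_congr rfl fun g _ => if_congr ⟨fun h => ⟨?_, ?_, ?_⟩, fun h v hv => ?_⟩ rfl rfl
  · exact fun v hv => (h v fun hv' => hZX v (hAZ (Finset.mem_sdiff.1 hv').1) hv).trans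
      (hg₁X v hv)
  · exact fun v hv => (h v fun hv' => (Finset.mem_sdiff.1 hv').2 hv).trans (hg₁Y v hv)
  · exact fun v hvX hvY hv => (h v hv).trans (hg₁0 v hvX hvY)
  · by_cases hvX : v ∈ X
    · rw [h.1 v hvX, hg₁X v hvX]
    · by_cases hvY : v ∈ Y
      · rw [h.2.1 v hvY, hg₁Y v hvY]
      · rw [h.2.2 v hvX hvY hv, hg₁0 v hvX hvY]
end
end

section
/- Let D be a node set in an MPDAG G = (V,E). Then there exists an ordering (B_1,…,B_k), k ≥ 1, of the buckets of the bucket decomposition of D such that for all i < j in {1,…,k}, B_i < B_j in G; that is, whenever there is an edge in G between a node A ∈ B_i and a node A' ∈ B_j with i < j, that edge is A → A'. -/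
open scoped Classical

noncomputable section

open PDG

/-- A finite set can be listed along an acyclic relation. -/
theorem Finset.exists_list_pairwise_not_swap {α : Type*} (r : α → α → Prop)
    (hr : ∀ a, ¬ Relation.TransGen r a a) (s : Finset α) :
    ∃ l : List α, (∀ a, a ∈ l ↔ a ∈ s) ∧ l.Pairwise fun a b => a ≠ b ∧ ¬ r b a := by
  have hantisymm : Std.Antisymm (Relation.ReflTransGen r) := ⟨fun a b hab hba => by
    rcases Relation.reflTransGen_iff_eq_or_transGen.1 hab with h | h
    · exact h.symm
    · exact (hr a (h.trans_left hba)).elim⟩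
  have hpartial : IsPartialOrder α (Relation.ReflTransGen r) := {}
  obtain ⟨le, hle, hrle⟩ := extend_partialOrder (Relation.ReflTransGen r)
  refine ⟨s.sort le, fun a => Finset.mem_sort le, ?_⟩
  refine ((s.pairwise_sort le).and (s.sort_nodup le)).imp ?_
  rintro a b ⟨hab, hne⟩
  exact ⟨hne, fun h => hne (antisymm_of le hab (hrle _ _ (Relation.ReflTransGen.single h)))⟩

theorem Finset.mem_foldr_union {α : Type*} [DecidableEq α] (l : List (Finset α)) (a : α) :
    a ∈ l.foldr (· ∪ ·) ∅ ↔ ∃ s ∈ l, a ∈ s := by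
  induction l with
  | nil => simp
  | cons s l ih => simp [ih]

namespace PDG

variable {V : Type} {G : PDG V}

/-- The simple graph formed by the undirected edges of a partially directed graph. -/
def undirGraph (G : PDG V) : SimpleGraph V where
  Adj := G.undir
  symm := ⟨G.undir_symm⟩
  loopless := ⟨G.undir_irrefl⟩

theorem undirConnected_iff {A : Finset V} :
    G.UndirConnected A ↔ ∀ a ∈ A, ∀ b ∈ A, G.undirGraph.Reachable a b := by
  refine forall₂_congr fun a _ => forall₂_congr fun b _ => ⟨fun h => ?_, ?_⟩
  · by_cases hab : a = b
    · exact hab ▸ SimpleGraph.Reachable.refl a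
    · obtain ⟨p, ⟨hp, -, hchain⟩, hhead, hlast⟩ := h hab
      rw [SimpleGraph.reachable_iff_reflTransGen]
      have h' := List.relationReflTransGen_of_exists_isChain p hchain hp
      rw [List.head?_eq_some_head hp, Option.some_inj] at hhead
      rw [List.getLast?_eq_some_getLast hp, Option.some_inj] at hlast
      rwa [hhead, hlast] at h'
  · intro h _
    obtain ⟨p, hp⟩ := h.exists_isPath
    refine ⟨p.support, ⟨p.support_ne_nil, hp.support_nodup, p.isChain_adj_support⟩, ?_, ?_⟩
    · rw [List.head?_eq_some_head p.support_ne_nil, p.head_support]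
    · rw [List.getLast?_eq_some_getLast p.support_ne_nil, p.getLast_support]

/-- The nodes of `D` in a fixed undirected component of `G` form a bucket. -/
theorem bucket_filter_connectedComponentMk {D : Finset V} {a : V} (ha : a ∈ D) :
    G.Bucket {v ∈ D | G.undirGraph.connectedComponentMk v =
      G.undirGraph.connectedComponentMk a} D := by
  refine ⟨⟨a, by simp [ha]⟩, Finset.filter_subset _ _, undirConnected_iff.2 ?_, ?_⟩
  · intro b hb c hc
    rw [Finset.mem_filter] at hb hc
    exact SimpleGraph.ConnectedComponent.exact (hb.2.trans hc.2.symm)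
  · intro B hsub hBD hB
    refine (Finset.Subset.antisymm hsub fun b hb => Finset.mem_filter.2 ⟨hBD hb, ?_⟩).symm
    exact SimpleGraph.ConnectedComponent.sound
      (undirConnected_iff.1 hB b hb a (hsub (by simp [ha])))

/-- In an MPDAG, a directed edge into an undirected component from outside extends to every
node of that component. -/
theorem IsMPDAG.dir_of_reachable (hG : G.IsMPDAG) {a b c : V} (hab : G.dir a b)
    (hne : ¬ G.undirGraph.Reachable a b) (hbc : G.undirGraph.Reachable b c) : G.dir a c := by
  rw [SimpleGraph.reachable_iff_reflTransGen] at hbc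
  induction hbc with
  | refl => exact hab
  | @tail c d hbc hcd ih =>
    rcases hG.meek1 a c d ih hcd with h | h | h
    · exact h
    · exact (hG.meek2 d a c h ih (G.undir_symm _ _ hcd)).elim
    · have had : G.undirGraph.Reachable a d := SimpleGraph.Adj.reachable h
      have hbd : G.undirGraph.Reachable b d :=
        (SimpleGraph.reachable_iff_reflTransGen _ _).2 (hbc.tail hcd)
      exact (hne (had.trans hbd.symm)).elim

/-- Some directed edge of `G` leads from the undirected component `C` to the distinct
undirected component `C'`. -/
def ComponentDir (G : PDG V) (C C' : G.undirGraph.ConnectedComponent) : Prop :=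
  C ≠ C' ∧ ∃ a b, G.undirGraph.connectedComponentMk a = C ∧
    G.undirGraph.connectedComponentMk b = C' ∧ G.dir a b

theorem IsMPDAG.exists_forall_dir (hG : G.IsMPDAG) {C C' : G.undirGraph.ConnectedComponent}
    (h : G.ComponentDir C C') : ∃ a, G.undirGraph.connectedComponentMk a = C ∧
      ∀ b, G.undirGraph.connectedComponentMk b = C' → G.dir a b := by
  obtain ⟨hne, a, b, rfl, rfl, hab⟩ := h
  exact ⟨a, rfl, fun c hc => hG.dir_of_reachable hab
    (fun h => hne (SimpleGraph.ConnectedComponent.sound h))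
    (SimpleGraph.ConnectedComponent.exact hc.symm)⟩

theorem IsMPDAG.not_transGen_componentDir (hG : G.IsMPDAG)
    (C : G.undirGraph.ConnectedComponent) : ¬ Relation.TransGen G.ComponentDir C C := by
  have key : ∀ C', Relation.TransGen G.ComponentDir C C' →
      ∃ a, G.undirGraph.connectedComponentMk a = C ∧
        ∀ b, G.undirGraph.connectedComponentMk b = C' → Relation.TransGen G.dir a b := by
    intro C' h
    induction h with
    | single h =>
      obtain ⟨a, ha, hab⟩ := hG.exists_forall_dir h
      exact ⟨a, ha, fun b hb => .single (hab b hb)⟩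
    | tail _ h ih =>
      obtain ⟨a, ha, hab⟩ := ih
      obtain ⟨b, hb, hbc⟩ := hG.exists_forall_dir h
      exact ⟨a, ha, fun c hc => (hab b hb).tail (hbc c hc)⟩
  intro h
  obtain ⟨a, ha, haa⟩ := key C h
  exact hG.acyclic a (haa a ha)

end PDG

/-- the buckets of a node set `D` can be ordered as a partial causal
ordering in `G`. -/
theorem stmt6 {V : Type} [Fintype V] [DecidableEq V]
    (G : PDG V) (hG : G.IsMPDAG) (D : Finset V) (hD : D.Nonempty) :
    ∃ Bs : List (Finset V), Bs ≠ [] ∧ G.IsBucketDecompList D Bs ∧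
      G.OrderedDecomp Bs := by
  obtain ⟨l, hl, hpair⟩ := Finset.exists_list_pairwise_not_swap G.ComponentDir
    hG.not_transGen_componentDir (D.image G.undirGraph.connectedComponentMk)
  set bucket : G.undirGraph.ConnectedComponent → Finset V :=
    fun C => {v ∈ D | G.undirGraph.connectedComponentMk v = C}
  have hmem : ∀ {v C}, v ∈ bucket C ↔ v ∈ D ∧ G.undirGraph.connectedComponentMk v = C :=
    Finset.mem_filter
  have hl_of_mem : ∀ v ∈ D, G.undirGraph.connectedComponentMk v ∈ l :=
    fun v hv => (hl _).2 (Finset.mem_image_of_mem _ hv)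
  refine ⟨l.map bucket, ?_, ⟨?_, ?_, ?_⟩, ?_⟩
  · obtain ⟨a, ha⟩ := hD
    exact List.ne_nil_of_mem (List.mem_map_of_mem (hl_of_mem a ha))
  · intro B hB
    obtain ⟨C, hC, rfl⟩ := List.mem_map.1 hB
    obtain ⟨a, ha, rfl⟩ := Finset.mem_image.1 ((hl C).1 hC)
    convert bucket_filter_connectedComponentMk (G := G) ha
  · refine List.pairwise_map.2 (hpair.imp fun {C C'} h => Finset.disjoint_left.2 ?_)
    exact fun v hv hv' => h.1 ((hmem.1 hv).2.symm.trans (hmem.1 hv').2)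
  · ext v
    rw [Finset.mem_foldr_union]
    constructor
    · rintro ⟨B, hB, hv⟩
      obtain ⟨C, -, rfl⟩ := List.mem_map.1 hB
      exact (hmem.1 hv).1
    · exact fun hv => ⟨_, List.mem_map_of_mem (hl_of_mem v hv), hmem.2 ⟨hv, rfl⟩⟩
  · have hordered : (l.map bucket).Pairwise
        fun B B' => ∀ a ∈ B, ∀ b ∈ B', G.Adj a b → G.dir a b := by
      refine List.pairwise_map.2 (hpair.imp fun {C C'} ⟨hne, hdir⟩ a ha b hb hab => ?_)
      have haC := (hmem.1 ha).2
      have hbC := (hmem.1 hb).2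
      rcases hab with h | h | h
      · exact h
      · exact (hdir ⟨hne.symm, b, a, hbC, haC, h⟩).elim
      · have hreach : G.undirGraph.Reachable a b := SimpleGraph.Adj.reachable h
        exact (hne (haC.symm.trans ((SimpleGraph.ConnectedComponent.sound hreach).trans hbC))).elim
    exact fun i j hij => List.pairwise_iff_get.1 hordered i j hij
end
end

section
/- Let B be a bucket in V in an MPDAG G = (V,E) and let X ∈ V with X ∉ B. If there is a causal path from X to some node of B in G, then for every node B' ∈ B there is a causal path from X to B' in G. -/
open scoped Classical

noncomputable section

open PDG

namespace List

variable {α : Type*} {r : α → α → Prop} {a b : α}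

theorem exists_nodup_isChain_of_reflTransGen (h : Relation.ReflTransGen r a b) :
    ∃ p : List α, p.Nodup ∧ p.IsChain r ∧ p.head? = some a ∧ p.getLast? = some b := by
  induction h using Relation.ReflTransGen.head_induction_on with
  | refl => exact ⟨[b], by simp⟩
  | @head c d hcd _ ih =>
    obtain ⟨p, hnd, hch, hhd, hlast⟩ := ih
    by_cases hc : c ∈ p
    · obtain ⟨s, t, rfl⟩ := List.append_of_mem hc
      refine ⟨c :: t, hnd.of_append_right, hch.right_of_append, rfl, ?_⟩
      simpa [List.getLast?_append] using hlast
    · obtain ⟨e, t, rfl⟩ : ∃ e t, p = e :: t := by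
        cases p with
        | nil => simp at hhd
        | cons e t => exact ⟨e, t, rfl⟩
      obtain rfl : e = d := by simpa using hhd
      exact ⟨c :: e :: t, List.nodup_cons.2 ⟨hc, hnd⟩, .cons_cons hcd hch, rfl,
        by simpa using hlast⟩

theorem IsChain.reflTransGen_of_head?_of_getLast? {p : List α} (hp : p.IsChain r)
    (ha : p.head? = some a) (hb : p.getLast? = some b) : Relation.ReflTransGen r a b := by
  cases p with
  | nil => simp at ha
  | cons c t =>
    obtain rfl : c = a := by simpa using ha
    refine List.relationReflTransGen_of_exists_isChain_cons t hp ?_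
    rw [List.getLast?_eq_some_getLast (List.cons_ne_nil _ _)] at hb
    exact Option.some.inj hb

end List

theorem Relation.ReflTransGen.exists_rel_entering {α : Type*} {r : α → α → Prop} {a b : α}
    {s : Set α} (h : Relation.ReflTransGen r a b) (ha : a ∉ s) (hb : b ∈ s) :
    ∃ u ∉ s, ∃ w ∈ s, Relation.ReflTransGen r a u ∧ r u w := by
  induction h with
  | refl => exact absurd hb ha
  | @tail c d hac hcd ih =>
    by_cases hc : c ∈ s
    · exact ih hc
    · exact ⟨c, hc, d, hb, hac, hcd⟩

namespace PDG

variable {V : Type} {G : PDG V} {B : Finset V} {a b : V}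

theorem UndirConnected.reflTransGen (hB : G.UndirConnected B) (ha : a ∈ B) (hb : b ∈ B) :
    Relation.ReflTransGen G.undir a b := by
  by_cases hab : a = b
  · exact hab ▸ .refl
  · obtain ⟨p, ⟨_, _, hp⟩, hpa, hpb⟩ := hB a ha b hb hab
    exact List.IsChain.reflTransGen_of_head?_of_getLast? hp hpa hpb

theorem Bucket.mem_of_undir [Fintype V] (hB : G.Bucket B Finset.univ) (ha : a ∈ B)
    (hab : G.undir a b) : b ∈ B := by
  have : Std.Symm G.undir := ⟨G.undir_symm⟩
  have hsymm : ∀ {x y}, Relation.ReflTransGen G.undir x y →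
      Relation.ReflTransGen G.undir y x := fun h =>
    Relation.ReflTransGen.stdSymm.symm _ _ h
  have hmax := hB.2.2.2 (Finset.univ.filter fun x => Relation.ReflTransGen G.undir a x)
    (fun x hx => by simpa using hB.2.2.1.reflTransGen ha hx) (Finset.subset_univ _) <| by
      intro x hx y hy _
      rw [Finset.mem_filter] at hx hy
      obtain ⟨p, hnd, hch, hpx, hpy⟩ :=
        List.exists_nodup_isChain_of_reflTransGen ((hsymm hx.2).trans hy.2)
      exact ⟨p, ⟨by rintro rfl; simp at hpx, hnd, hch⟩, hpx, hpy⟩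
  rw [← hmax]
  simpa using Relation.ReflTransGen.single hab

theorem IsMPDAG.dir_of_dir_bucket [Fintype V] (hG : G.IsMPDAG) (hB : G.Bucket B Finset.univ)
    {u : V} (hu : u ∉ B) (ha : a ∈ B) (hua : G.dir u a) (hb : b ∈ B) : G.dir u b := by
  suffices b ∈ B ∧ G.dir u b from this.2
  induction hB.2.2.1.reflTransGen ha hb with
  | refl => exact ⟨ha, hua⟩
  | @tail c d _ hcd ih =>
    have hc : c ∈ B := by
      by_contra hc
      exact hc (hB.mem_of_undir hb (G.undir_symm _ _ hcd))
    obtain ⟨_, huc⟩ := ih hc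
    refine ⟨hb, ?_⟩
    rcases hG.meek1 u c d huc hcd with h | h | h
    · exact h
    · exact absurd (G.undir_symm _ _ hcd) (hG.meek2 d u c h huc)
    · exact absurd (hB.mem_of_undir hb (G.undir_symm _ _ h)) hu

end PDG

/-- if there is a causal path from `X ∉ B` to some node of a bucket `B`
in `V`, then there is a causal path from `X` to every node of `B`. -/
theorem stmt8 {V : Type} [Fintype V] [DecidableEq V]
    (G : PDG V) (hG : G.IsMPDAG) (B : Finset V) (hB : G.Bucket B Finset.univ)
    (X : V) (hX : X ∉ B)
    (h : ∃ b ∈ B, ∃ p, G.IsCausal p ∧ p.head? = some X ∧ p.getLast? = some b) :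
    ∀ b' ∈ B, ∃ p, G.IsCausal p ∧ p.head? = some X ∧ p.getLast? = some b' := by
  obtain ⟨b, hb, p, ⟨_, _, hp⟩, hpX, hpb⟩ := h
  intro b' hb'
  obtain ⟨u, hu, w, hw, hXu, huw⟩ :=
    (List.IsChain.reflTransGen_of_head?_of_getLast? hp hpX hpb).exists_rel_entering
      (s := (B : Set V)) hX hb
  obtain ⟨q, hnd, hch, hqX, hqb⟩ := List.exists_nodup_isChain_of_reflTransGen
    (hXu.tail (hG.dir_of_dir_bucket hB hu hw huw hb'))
  refine ⟨q, ⟨?_, hnd, hch⟩, hqX, hqb⟩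
  match q, hqX, hqb with
  | [c], hqX, hqb =>
    simp only [List.head?_cons, List.getLast?_singleton, Option.some.injEq] at hqX hqb
    exact absurd (hqX ▸ hqb ▸ hb') hX
  | _ :: _ :: _, _, _ => simp
end
end
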